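/- For all ε with 0 ≤ ε ≤ 1, log(cos(2ε/π)) + (4ε/π²)·log(1+ε) ≥ ε²/(8(1+ε)). -/

import Mathlib

open Real

/-- A function vanishing at `0` with nonnegative derivative on `[0, b]` is nonnegative there. -/
lemma nonneg_of_hasDerivAt_nonneg {f f' : ℝ → ℝ} {b x : ℝ} (hf0 : f 0 = 0)
    (hf : ∀ y ∈ Set.Icc 0 b, HasDerivAt f (f' y) y) (hf' : ∀ y ∈ Set.Icc 0 b, 0 ≤ f' y)
    (hx : x ∈ Set.Icc 0 b) : 0 ≤ f x := by
  have hmono : MonotoneOn f (Set.Icc 0 b) := by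
    refine monotoneOn_of_hasDerivWithinAt_nonneg (f' := f') (convex_Icc 0 b)
      (fun y hy ↦ (hf y hy).continuousAt.continuousWithinAt)
      (fun y hy ↦ (hf y (interior_subset hy)).hasDerivWithinAt)
      (fun y hy ↦ hf' y (interior_subset hy))
  rw [← hf0]
  exact hmono ⟨le_rfl, hx.1.trans hx.2⟩ hx hx.1

/-- A polynomial upper bound for the tangent near `0`, obtained by comparing `x` with the
arctangent of the polynomial. -/
lemma tan_le_poly {x : ℝ} (h0 : 0 ≤ x) (h1 : x ≤ 16 / 25) :
    tan x ≤ x + x ^ 3 / 3 + 2 * x ^ 5 / 15 + 2 * x ^ 7 / 25 := by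
  have key : 0 ≤ arctan (x + x ^ 3 / 3 + 2 * x ^ 5 / 15 + 2 * x ^ 7 / 25) - x := by
    refine nonneg_of_hasDerivAt_nonneg (b := 16 / 25)
      (f := fun y ↦ arctan (y + y ^ 3 / 3 + 2 * y ^ 5 / 15 + 2 * y ^ 7 / 25) - y)
      (f' := fun y ↦ 1 / (1 + (y + y ^ 3 / 3 + 2 * y ^ 5 / 15 + 2 * y ^ 7 / 25) ^ 2) *
        (1 + y ^ 2 + 2 * y ^ 4 / 3 + 14 * y ^ 6 / 25) - 1) (by simp) (fun y _ ↦ ?_)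
      (fun y hy ↦ ?_) ⟨h0, h1⟩
    · have hpoly : HasDerivAt (fun y : ℝ ↦ y + y ^ 3 / 3 + 2 * y ^ 5 / 15 + 2 * y ^ 7 / 25)
          (1 + y ^ 2 + 2 * y ^ 4 / 3 + 14 * y ^ 6 / 25) y := by
        refine ((((hasDerivAt_id y).add ((hasDerivAt_pow 3 y).div_const 3)).add
          (((hasDerivAt_pow 5 y).const_mul 2).div_const 15)).add
          (((hasDerivAt_pow 7 y).const_mul 2).div_const 25)).congr_deriv ?_
        norm_num
        ring
      exact hpoly.arctan.sub (hasDerivAt_id y)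
    · obtain ⟨hy0, hy1⟩ := hy
      have hs : y ^ 2 ≤ 41 / 100 := by nlinarith
      have hs0 : 0 ≤ y ^ 2 := sq_nonneg y
      have hle : 1 + (y + y ^ 3 / 3 + 2 * y ^ 5 / 15 + 2 * y ^ 7 / 25) ^ 2 ≤
          1 + y ^ 2 + 2 * y ^ 4 / 3 + 14 * y ^ 6 / 25 := by
        have hfac : 0 ≤ (y ^ 2) ^ 3 * (14 / 25 - 17 / 45 - 56 / 225 * y ^ 2
            - 4 / 225 * (y ^ 2) ^ 2 - 4 / 75 * (y ^ 2) ^ 2 - 8 / 375 * (y ^ 2) ^ 3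
            - 4 / 625 * (y ^ 2) ^ 4) := by
          refine mul_nonneg (by positivity) ?_
          have := pow_le_pow_left₀ hs0 hs 2
          have := pow_le_pow_left₀ hs0 hs 3
          have := pow_le_pow_left₀ hs0 hs 4
          norm_num at *
          linarith
        linear_combination hfac
      have : 1 ≤ 1 / (1 + (y + y ^ 3 / 3 + 2 * y ^ 5 / 15 + 2 * y ^ 7 / 25) ^ 2) *
          (1 + y ^ 2 + 2 * y ^ 4 / 3 + 14 * y ^ 6 / 25) := by
        rw [one_div_mul_eq_div, one_le_div (by positivity)]
        exact hle
      linarith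
  have hpi := pi_gt_three
  rw [← tan_arctan (x + x ^ 3 / 3 + 2 * x ^ 5 / 15 + 2 * x ^ 7 / 25)]
  exact strictMonoOn_tan.monotoneOn ⟨by linarith, by linarith⟩
    ⟨neg_pi_div_two_lt_arctan _, arctan_lt_pi_div_two _⟩ (by linarith)

lemma poly_le_log_cos {x : ℝ} (h0 : 0 ≤ x) (h1 : x ≤ 16 / 25) :
    -(x ^ 2 / 2 + x ^ 4 / 12 + x ^ 6 / 45 + x ^ 8 / 100) ≤ log (cos x) := by
  have key : 0 ≤ log (cos x) + (x ^ 2 / 2 + x ^ 4 / 12 + x ^ 6 / 45 + x ^ 8 / 100) := by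
    refine nonneg_of_hasDerivAt_nonneg (b := 16 / 25)
      (f := fun y ↦ log (cos y) + (y ^ 2 / 2 + y ^ 4 / 12 + y ^ 6 / 45 + y ^ 8 / 100))
      (f' := fun y ↦ -tan y + (y + y ^ 3 / 3 + 2 * y ^ 5 / 15 + 2 * y ^ 7 / 25))
      (by simp) (fun y hy ↦ ?_) (fun y hy ↦ ?_) ⟨h0, h1⟩
    · have hpi := pi_gt_three
      have hcos : 0 < cos y := cos_pos_of_mem_Ioo ⟨by linarith [hy.1], by linarith [hy.2]⟩
      have hlog : HasDerivAt (fun y ↦ log (cos y)) (-tan y) y := by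
        convert (hasDerivAt_cos y).log hcos.ne' using 1
        rw [tan_eq_sin_div_cos, neg_div]
      refine hlog.add ?_
      refine (((((hasDerivAt_pow 2 y).div_const 2).add
        ((hasDerivAt_pow 4 y).div_const 12)).add ((hasDerivAt_pow 6 y).div_const 45)).add
        ((hasDerivAt_pow 8 y).div_const 100)).congr_deriv ?_
      norm_num
      ring
    · linarith [tan_le_poly hy.1 hy.2]
  linarith

/-- The first three terms of the expansion of `log (1 + x)` in powers of `x / (2 + x)`. -/
lemma sum_le_log_one_add {x : ℝ} (hx : 0 ≤ x) :
    2 * (x / (2 + x) + (x / (2 + x)) ^ 3 / 3 + (x / (2 + x)) ^ 5 / 5) ≤ log (1 + x) := by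
  have hlt : x / (2 + x) < 1 := by
    rw [div_lt_one (by linarith)]
    linarith
  have h := sum_range_le_log_div (x := x / (2 + x)) (by positivity) hlt 3
  have heq : (1 + x / (2 + x)) / (1 - x / (2 + x)) = 1 + x := by
    have : 2 + x ≠ 0 := by positivity
    have : 1 - x / (2 + x) = 2 / (2 + x) := by
      field_simp
      ring
    rw [this]
    field_simp
    ring
  rw [heq] at h
  norm_num [Finset.sum_range_succ] at h
  linarith

/-- The rational inequality left after replacing both logarithms by their lower bounds and
`4 / π ^ 2` by rational bounds. -/
lemma rational_lower_bound {x : ℝ} (h0 : 0 ≤ x) (h1 : x ≤ 1) :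
    1 / (8 * (1 + x)) + ((0.4054 : ℝ) ^ 2 * x ^ 2 / 12 + (0.4054 : ℝ) ^ 3 * x ^ 4 / 45 +
      (0.4054 : ℝ) ^ 4 * x ^ 6 / 100) ≤
    0.4052 * (2 * (1 / (2 + x) + x ^ 2 / (2 + x) ^ 3 / 3 + x ^ 4 / (2 + x) ^ 5 / 5) - 1 / 2) := by
  have hp (n : ℕ) : x ^ (n + 1) ≤ x ^ n := pow_le_pow_of_le_one h0 h1 n.le_succ
  have h2 : 0 < 2 + x := by linarith
  have hx1 : 0 < 1 + x := by linarith
  rw [← sub_nonneg]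
  have hpoly : 0 ≤ 0.4052 * (2 * (2 + x) ^ 4 + 2 / 3 * x ^ 2 * (2 + x) ^ 2 + 2 / 5 * x ^ 4
      - 1 / 2 * (2 + x) ^ 5) * (1 + x) - (2 + x) ^ 5 / 8
      - ((0.4054 : ℝ) ^ 2 * x ^ 2 / 12 + (0.4054 : ℝ) ^ 3 * x ^ 4 / 45 +
      (0.4054 : ℝ) ^ 4 * x ^ 6 / 100) * (2 + x) ^ 5 * (1 + x) := by
    have q0 := hp 0
    have q1 := hp 1
    have q2 := hp 2
    have q3 := hp 3
    have q4 := hp 4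
    have q5 := hp 5
    have q6 := hp 6
    have q7 := hp 7
    have q8 := hp 8
    have q9 := hp 9
    have q10 := hp 10
    have q11 := hp 11
    have q12 : 0 ≤ x ^ 12 := by positivity
    norm_num at q0 q1 q2 q3 q4 q5 q6 q7 q8 q9 q10 q11 ⊢
    linarith
  refine (div_nonneg hpoly (by positivity : 0 ≤ (2 + x) ^ 5 * (1 + x))).trans_eq ?_
  field_simp
  ring

/-- Key analytic inequality for the exponential tail bound of the geometric
mean estimator: for `0 ≤ ε ≤ 1`,
`log(cos(2ε/π)) + (4ε/π²) log(1+ε) ≥ ε²/(8(1+ε))`. -/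
theorem log_cos_ineq (ε : ℝ) (h0 : 0 ≤ ε) (h1 : ε ≤ 1) :
    Real.log (Real.cos (2 * ε / π)) + (4 * ε / π ^ 2) * Real.log (1 + ε)
      ≥ ε ^ 2 / (8 * (1 + ε)) := by
  have hpl := pi_gt_d4
  have hpu := pi_lt_d4
  have hx : 2 * ε / π ≤ 16 / 25 := by
    rw [div_le_iff₀ pi_pos]
    linarith
  have hcos := poly_le_log_cos (x := 2 * ε / π) (by positivity) hx
  have hlog := sum_le_log_one_add h0
  have hrat := mul_le_mul_of_nonneg_left (rational_lower_bound h0 h1) (sq_nonneg ε)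
  obtain ⟨c, hc⟩ : ∃ c, c = 4 / π ^ 2 := ⟨_, rfl⟩
  have hcl : 0.4052 ≤ c := by
    rw [hc, le_div_iff₀ (by positivity)]
    nlinarith
  have hcu : c ≤ 0.4054 := by
    rw [hc, div_le_iff₀ (by positivity)]
    nlinarith
  have hc0 : 0 ≤ c := by linarith
  have hsq : (2 * ε / π) ^ 2 = c * ε ^ 2 := by rw [hc]; ring
  have hcε : 4 * ε / π ^ 2 = c * ε := by rw [hc]; ring
  rw [show -((2 * ε / π) ^ 2 / 2 + (2 * ε / π) ^ 4 / 12 + (2 * ε / π) ^ 6 / 45 +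
      (2 * ε / π) ^ 8 / 100) = -((2 * ε / π) ^ 2 / 2 + ((2 * ε / π) ^ 2) ^ 2 / 12 +
      ((2 * ε / π) ^ 2) ^ 3 / 45 + ((2 * ε / π) ^ 2) ^ 4 / 100) by ring, hsq] at hcos
  rw [hcε]
  have hmul := mul_le_mul_of_nonneg_left hlog (by positivity : 0 ≤ c * ε)
  have hc2 := mul_le_mul_of_nonneg_right (pow_le_pow_left₀ hc0 hcu 2) (by positivity : 0 ≤ ε ^ 4)
  have hc3 := mul_le_mul_of_nonneg_right (pow_le_pow_left₀ hc0 hcu 3) (by positivity : 0 ≤ ε ^ 6)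
  have hc4 := mul_le_mul_of_nonneg_right (pow_le_pow_left₀ hc0 hcu 4) (by positivity : 0 ≤ ε ^ 8)
  have hfac : 0 ≤ 2 * (1 / (2 + ε) + ε ^ 2 / (2 + ε) ^ 3 / 3 + ε ^ 4 / (2 + ε) ^ 5 / 5)
      - 1 / 2 := by
    have : 1 / 3 ≤ 1 / (2 + ε) := one_div_le_one_div_of_le (by linarith) (by linarith)
    have : 0 ≤ ε ^ 2 / (2 + ε) ^ 3 / 3 := by positivity
    have : 0 ≤ ε ^ 4 / (2 + ε) ^ 5 / 5 := by positivity
    linarith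
  have hcfac := mul_le_mul_of_nonneg_left (mul_le_mul_of_nonneg_right hcl hfac) (sq_nonneg ε)
  have hquot : ε ^ 2 / (8 * (1 + ε)) = ε ^ 2 * (1 / (8 * (1 + ε))) := by ring
  have hexp : c * ε * (2 * (ε / (2 + ε) + (ε / (2 + ε)) ^ 3 / 3 + (ε / (2 + ε)) ^ 5 / 5)) =
      ε ^ 2 * (c * (2 * (1 / (2 + ε) + ε ^ 2 / (2 + ε) ^ 3 / 3 + ε ^ 4 / (2 + ε) ^ 5 / 5)
      - 1 / 2)) + c * ε ^ 2 / 2 := by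
    have : 2 + ε ≠ 0 := by positivity
    field_simp
    ring
  rw [hquot]
  linarith
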